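/- For all integers k, t ≥ 1 and d ≥ 2, there exists a constant c such that every graph G with no clique of size t and with chromatic number greater than c admits a path-induced, level-stable, type-uniform copy of (T_d^k, r). -/

import Mathlib

open SimpleGraph

/-- A walk `p` in `G` is an *induced path* if it is a path and two vertices on it are
adjacent in `G` exactly when they are consecutive on the walk. -/
def IsInducedPathWalk {V : Type*} (G : SimpleGraph V) {a b : V} (p : G.Walk a b) : Prop :=
  p.IsPath ∧ ∀ i j : Fin p.support.length,
    G.Adj (p.support.get i) (p.support.get j) ↔ ((i : ℕ) + 1 = (j : ℕ) ∨ (j : ℕ) + 1 = (i : ℕ))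

/-- A *path-induced copy* of a rooted tree `(T, r)` in `G`: an injective graph homomorphism
`φ : T →g G` such that the image of every path of `T` with one end `r` is an induced path
of `G`. -/
def IsPathInducedCopy {α W : Type*} (T : SimpleGraph α) (r : α) (G : SimpleGraph W)
    (φ : T →g G) : Prop :=
  Function.Injective φ ∧
    ∀ (v : α) (p : T.Walk r v), p.IsPath → IsInducedPathWalk G (p.map φ)

/-- `X` is a `c`-creature of `G` if every vertex in `X` has fewer than `c` neighbours
outside `X`. -/
def IsCreature {V : Type*} (G : SimpleGraph V) (c : ℕ) (X : Set V) : Prop :=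
  ∀ v ∈ X, (G.neighborSet v \ X).ncard < c

/-- Vertices of the rooted tree `T_d^k`: a vertex at depth `j ≤ k` is a list
`[a_j, …, a_1]` of child labels read from the vertex up to the root, where the label
`a_1` of a child of the root lies in `{0, …, d-1}` (the root has `d` children) and all
other labels lie in `{0, …, d-2}` (each non-root internal vertex has `d-1` children,
hence degree `d`). -/
def TdkVertex (d k : ℕ) : Type :=
  {l : List ℕ // l.length ≤ k ∧ (∀ x ∈ l, x < d) ∧ ∀ x ∈ l.dropLast, x < d - 1}

/-- The tree `T_d^k`: the root has degree `d`, every vertex has degree `d` or `1`, and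
every root-to-leaf path has length `k`.  Two vertices are adjacent iff one is obtained
from the other by prepending one child label. -/
def Tdk (d k : ℕ) : SimpleGraph (TdkVertex d k) :=
  SimpleGraph.fromRel (fun u v => ∃ a : ℕ, v.val = a :: u.val)

/-- The root of `T_d^k`. -/
def TdkRoot (d k : ℕ) : TdkVertex d k :=
  ⟨[], by simp⟩

/-- Length of the longest common suffix of two lists.  For two vertices of `T_d^k`
(encoded as lists of child labels read from the vertex towards the root) this is the
depth of their join (their common ancestor furthest from the root). -/
def lcsLen (u v : List ℕ) : ℕ :=
  ((u.reverse.zip v.reverse).takeWhile (fun p => p.1 == p.2)).length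

/-- Two vertices of `T_d^k` (as lists) are incomparable iff neither is an ancestor of the
other, i.e. neither list is a suffix of the other. -/
def Incomp (u v : List ℕ) : Prop := ¬ u <:+ v ∧ ¬ v <:+ u

/-- The label of the child of the join of `u` and `v` from which `u` descends. -/
def branchLabel (u v : List ℕ) : ℕ := u.getD (u.length - lcsLen u v - 1) 0

/-- `u` is earlier than `v` (with children of each vertex ordered by their labels). -/
def Earlier (u v : List ℕ) : Prop := branchLabel u v < branchLabel v u

/-- The vertices in `S` can be properly coloured with colours `0, …, m - 1`. -/
def ColorableOn {V : Type*} (G : SimpleGraph V) (S : Set V) (m : ℕ) : Prop :=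
  ∃ f : V → ℕ, (∀ v ∈ S, f v < m) ∧ ∀ u ∈ S, ∀ v ∈ S, G.Adj u v → f u ≠ f v

/-- Every nonempty subset of `W` that is a `c`-creature of the subgraph induced on `W` has
chromatic number greater than `m`. -/
def NoCreature {V : Type*} (G : SimpleGraph V) (c m : ℕ) (W : Set V) : Prop :=
  ∀ X ⊆ W, X.Nonempty → (∀ v ∈ X, (G.neighborSet v ∩ (W \ X)).ncard < c) → ¬ ColorableOn G X m

lemma ColorableOn.union {V : Type*} {G : SimpleGraph V} {S T : Set V} {m n : ℕ}
    (hS : ColorableOn G S m) (hT : ColorableOn G T n) : ColorableOn G (S ∪ T) (m + n) := by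
  classical
  obtain ⟨f, hf, hf'⟩ := hS
  obtain ⟨g, hg, hg'⟩ := hT
  refine ⟨fun v => if v ∈ S then f v else m + g v, ?_, ?_⟩
  · intro v hv
    by_cases h : v ∈ S
    · have := hf v h
      simp only [h, if_true]; omega
    · have := hg v (hv.resolve_left h)
      simp only [h, if_false]; omega
  · intro u hu v hv huv
    by_cases h : u ∈ S <;> by_cases h' : v ∈ S <;> simp only [h, h', if_true, if_false]
    · exact hf' u h v h' huv
    · have := hf u h; omega
    · have := hf v h'; omega
    · have := hg' u (hu.resolve_left h) v (hv.resolve_left h') huv; omega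

lemma ColorableOn.mono {V : Type*} {G : SimpleGraph V} {S T : Set V} {m : ℕ}
    (hT : ColorableOn G T m) (h : S ⊆ T) : ColorableOn G S m := by
  obtain ⟨f, hf, hf'⟩ := hT
  exact ⟨f, fun v hv => hf v (h hv), fun u hu v hv => hf' u (h hu) v (h hv)⟩

lemma colorableOn_singleton {V : Type*} (G : SimpleGraph V) (v : V) :
    ColorableOn G {v} 1 := by
  refine ⟨fun _ => 0, fun _ _ => one_pos, ?_⟩
  rintro u rfl w rfl h
  exact absurd h (G.loopless.irrefl _)

/-- Repeatedly removing `c`-creatures of chromatic number at most `m` from `U` removes a set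
that is `m * c`-colourable, and leaves a set without such creatures. -/
lemma exists_noCreature_diff {V : Type*} [Finite V] (G : SimpleGraph V) (c m : ℕ) (U : Set V) :
    ∃ Z ⊆ U, NoCreature G c m (U \ Z) ∧ ColorableOn G Z (m * c) ∧
      ∀ z ∈ Z, (G.neighborSet z ∩ (U \ Z)).ncard < c := by
  classical
  suffices H : ∀ n, ∀ U : Set V, U.ncard = n → ∃ Z ⊆ U, NoCreature G c m (U \ Z) ∧
      (∃ f g : V → ℕ, (∀ v ∈ Z, f v < m ∧ g v < c) ∧
        ∀ u ∈ Z, ∀ v ∈ Z, G.Adj u v → f u ≠ f v ∨ g u ≠ g v) ∧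
      ∀ z ∈ Z, (G.neighborSet z ∩ (U \ Z)).ncard < c by
    obtain ⟨Z, hZU, hZ, ⟨f, g, hfg, hfg'⟩, hdeg⟩ := H _ U rfl
    refine ⟨Z, hZU, hZ, ⟨fun v => f v * c + g v, ?_, ?_⟩, hdeg⟩
    · intro v hv
      obtain ⟨h1, h2⟩ := hfg v hv
      calc f v * c + g v < f v * c + c := by omega
        _ = (f v + 1) * c := by ring
        _ ≤ m * c := Nat.mul_le_mul_right _ h1
    · intro u hu v hv huv heq
      have hu2 := (hfg u hu).2
      have hv2 := (hfg v hv).2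
      have hc : 0 < c := by omega
      have hmod : g u = g v := by
        have := congrArg (· % c) heq
        simpa [Nat.mul_add_mod', Nat.mod_eq_of_lt hu2, Nat.mod_eq_of_lt hv2] using this
      rcases hfg' u hu v hv huv with h | h
      · refine h (Nat.eq_of_mul_eq_mul_right hc ?_)
        simp only at heq
        omega
      · exact h hmod
  intro n
  induction n using Nat.strong_induction_on with
  | _ n ih =>
    intro U hU
    by_cases hcf : NoCreature G c m U
    · exact ⟨∅, Set.empty_subset _, by simpa using hcf, ⟨fun _ => 0, fun _ => 0, by simp⟩, by simp⟩
    simp only [NoCreature] at hcf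
    push Not at hcf
    obtain ⟨X, hXU, hXne, hXdeg, a, ha, ha'⟩ := hcf
    have hlt : (U \ X).ncard < n := by
      rw [← hU]
      refine Set.ncard_lt_ncard ?_ (Set.toFinite _)
      obtain ⟨x, hx⟩ := hXne
      exact ⟨Set.sdiff_subset, fun h => (h (hXU hx)).2 hx⟩
    obtain ⟨Z, hZU, hZ, ⟨f, g, hfg, hfg'⟩, hdeg⟩ := ih _ hlt _ rfl
    have hdis : ∀ z ∈ Z, z ∉ X := fun z hz => (hZU hz).2
    have hset : U \ (X ∪ Z) = (U \ X) \ Z := by rw [Set.sdiff_sdiff]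
    have hex : ∀ x ∈ X, ∃ i < c, ∀ z ∈ Z, G.Adj x z → g z ≠ i := by
      intro x hx
      by_contra hcon
      push Not at hcon
      have hsub : (Finset.range c : Set ℕ) ⊆ g '' (G.neighborSet x ∩ (U \ X)) := by
        intro i hi
        obtain ⟨z, hz, hxz, hgz⟩ := hcon i (by simpa using hi)
        exact ⟨z, ⟨hxz, hZU hz⟩, hgz⟩
      have h1 := Set.ncard_le_ncard hsub (Set.toFinite _)
      have h2 := Set.ncard_image_le (f := g) (Set.toFinite (G.neighborSet x ∩ (U \ X)))
      have h3 := hXdeg x hx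
      rw [Set.ncard_coe_finset, Finset.card_range] at h1
      omega
    choose! b hb hb' using hex
    refine ⟨X ∪ Z, Set.union_subset hXU (hZU.trans Set.sdiff_subset), by rwa [hset], ?_, ?_⟩
    · refine ⟨fun v => if v ∈ X then a v else f v, fun v => if v ∈ X then b v else g v, ?_, ?_⟩
      · rintro v (hv | hv)
        · simpa [hv] using ⟨ha v hv, hb v hv⟩
        · simpa [hdis v hv] using hfg v hv
      · rintro u (hu | hu) v (hv | hv) huv
        · left; simpa [hu, hv] using ha' u hu v hv huv
        · right; simpa [hu, hdis v hv] using (hb' u hu v hv huv).symm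
        · right; simpa [hv, hdis u hu] using hb' v hv u hu huv.symm
        · simpa [hdis u hu, hdis v hv] using hfg' u hu v hv huv
    · rw [hset]
      rintro z (hz | hz)
      · refine lt_of_le_of_lt (Set.ncard_le_ncard ?_ (Set.toFinite _)) (hXdeg z hz)
        exact Set.inter_subset_inter_right _ Set.sdiff_subset
      · exact hdeg z hz

lemma NoCreature.diff {V : Type*} [Finite V] {G : SimpleGraph V} {c m s : ℕ} {W F : Set V}
    (h : NoCreature G (c + s) m W) (hF : F.ncard ≤ s) : NoCreature G c m (W \ F) := by
  intro X hX hne hdeg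
  refine h X (hX.trans Set.sdiff_subset) hne fun v hv => ?_
  have hsub : G.neighborSet v ∩ (W \ X) ⊆ (G.neighborSet v ∩ ((W \ F) \ X)) ∪ F := by
    rintro x ⟨h1, h2, h3⟩
    by_cases hx : x ∈ F
    · exact Or.inr hx
    · exact Or.inl ⟨h1, ⟨h2, hx⟩, h3⟩
  have h1 := Set.ncard_le_ncard hsub (Set.toFinite _)
  have h2 := Set.ncard_union_le (G.neighborSet v ∩ ((W \ F) \ X)) F
  have h3 := hdeg v hv
  omega

lemma NoCreature.insert {V : Type*} [Finite V] {G : SimpleGraph V} {c m : ℕ} {W : Set V} {v : V}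
    (h : NoCreature G c m W) (hv : c ≤ (G.neighborSet v ∩ W).ncard) :
    NoCreature G c m (insert v W) := by
  intro X hX hne hdeg hcol
  have hle : ∀ x, (G.neighborSet x ∩ (W \ X)).ncard ≤
      (G.neighborSet x ∩ (Insert.insert v W \ X)).ncard := fun x =>
    Set.ncard_le_ncard (by intro y; simp; tauto) (Set.toFinite _)
  have hXW : (X ∩ W).Nonempty := by
    by_contra hcon
    rw [Set.not_nonempty_iff_eq_empty] at hcon
    have hd : W \ X = W := by
      ext y
      simp only [Set.mem_sdiff, and_iff_left_iff_imp]
      intro hy hyX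
      have : y ∈ X ∩ W := ⟨hyX, hy⟩
      simp [hcon] at this
    obtain ⟨x, hx⟩ := hne
    have hxv : x = v := by
      rcases hX hx with h' | h'
      · exact h'
      · have : x ∈ X ∩ W := ⟨hx, h'⟩
        simp [hcon] at this
    subst hxv
    have h1 := hle x
    have h2 := hdeg x hx
    rw [hd] at h1
    omega
  refine h (X ∩ W) Set.inter_subset_right hXW (fun x hx => ?_) (hcol.mono Set.inter_subset_left)
  rw [Set.sdiff_inter_self_eq_sdiff]
  exact (hle x).trans_lt (hdeg x hx.1)

/-- Lists of length at most `k` with entries less than `D`; they are the vertices of the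
tree of height `k` in which every non-leaf has `D` children, read from the vertex to the root. -/
def treeLists (D k : ℕ) : Set (List ℕ) := {l | l.length ≤ k ∧ ∀ x ∈ l, x < D}

lemma finite_treeLists (D k : ℕ) : (treeLists D k).Finite := by
  induction k with
  | zero =>
    refine (Set.finite_singleton ([] : List ℕ)).subset ?_
    rintro l ⟨h, -⟩
    simpa using h
  | succ k ih =>
    refine ((Set.finite_singleton ([] : List ℕ)).union
      (((Set.finite_Iio D).prod ih).image fun p => p.1 :: p.2)).subset ?_
    rintro (_ | ⟨a, l⟩) ⟨h, h'⟩
    · exact Or.inl rfl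
    · refine Or.inr ⟨(a, l), ⟨h' a (by simp), ?_, fun x hx => h' x (by simp [hx])⟩, rfl⟩
      simpa using h

lemma mem_treeLists_of_append {D k : ℕ} {l x : List ℕ} (h : l ++ x ∈ treeLists D k) :
    x ∈ treeLists D k := by
  obtain ⟨h1, h2⟩ := h
  refine ⟨by simp at h1; omega, fun y hy => h2 y (by simp [hy])⟩

/-- `φ` is a path-induced copy in `G` of the tree of height `k` in which every non-leaf has
`D` children. -/
structure IsListTreeCopy {V : Type*} (G : SimpleGraph V) (D k : ℕ) (φ : List ℕ → V) : Prop where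
  injOn : Set.InjOn φ (treeLists D k)
  adj_iff : ∀ l x, l ++ x ∈ treeLists D k → (G.Adj (φ (l ++ x)) (φ x) ↔ l.length = 1)

/-- Path-induced copies of trees of height `k` whose roots are neighbours of `v`, and which contain
no other neighbour of `v`, can be joined at `v`. -/
lemma IsListTreeCopy.join {V : Type*} {G : SimpleGraph V} {D k : ℕ} {v : V} {Φ : ℕ → List ℕ → V}
    (hΦ : ∀ a < D, IsListTreeCopy G D k (Φ a)) (hv : ∀ a < D, ∀ l ∈ treeLists D k, Φ a l ≠ v)
    (hadj : ∀ a < D, ∀ l ∈ treeLists D k, G.Adj (Φ a l) v ↔ l = [])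
    (hdis : ∀ a < D, ∀ b < D, a ≠ b → ∀ l ∈ treeLists D k, ∀ l' ∈ treeLists D k,
      Φ a l ≠ Φ b l') :
    IsListTreeCopy G D (k + 1)
      (fun l => if h : l = [] then v else Φ (l.getLast h) l.dropLast) := by
  have key : ∀ l a, l ++ [a] ∈ treeLists D (k + 1) → l ∈ treeLists D k ∧ a < D := by
    rintro l a ⟨h1, h2⟩
    refine ⟨⟨by simpa using h1, fun x hx => h2 x (by simp [hx])⟩, h2 a (by simp)⟩
  constructor
  · intro l hl l' hl' heq
    rcases List.eq_nil_or_concat' l with rfl | ⟨l, a, rfl⟩ <;>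
      rcases List.eq_nil_or_concat' l' with rfl | ⟨l', a', rfl⟩
    · rfl
    · obtain ⟨h1, h2⟩ := key _ _ hl'
      exact absurd (by simpa using heq.symm) (hv _ h2 _ h1)
    · obtain ⟨h1, h2⟩ := key _ _ hl
      exact absurd (by simpa using heq) (hv _ h2 _ h1)
    · obtain ⟨h1, h2⟩ := key _ _ hl
      obtain ⟨h3, h4⟩ := key _ _ hl'
      have heq' : Φ a l = Φ a' l' := by simpa using heq
      by_cases haa : a = a'
      · subst haa
        rw [(hΦ a h2).injOn h1 h3 heq']
      · exact absurd heq' (hdis _ h2 _ h4 haa _ h1 _ h3)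
  · intro l x hl
    rcases List.eq_nil_or_concat' x with rfl | ⟨x, a, rfl⟩
    · rcases List.eq_nil_or_concat' l with rfl | ⟨l, a, rfl⟩
      · simp
      · obtain ⟨h1, h2⟩ := key l a (by simpa using hl)
        simpa using hadj a h2 l h1
    · rw [← List.append_assoc] at hl
      obtain ⟨h1, h2⟩ := key _ _ hl
      have := (hΦ a h2).adj_iff l x h1
      simpa [← List.append_assoc] using this

/-- Disjoint trees can be grown greedily from distinct vertices with many neighbours in `W`. -/
lemma exists_disjoint_copies {V : Type*} [Finite V] {G : SimpleGraph V} {D k c m n m₀ : ℕ}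
    {U W : Set V} (hloc : ∀ v ∈ U, ColorableOn G (G.neighborSet v ∩ U) m₀)
    (ih : ∀ W' : Set V, (∀ v ∈ W', ColorableOn G (G.neighborSet v ∩ W') m₀) →
      NoCreature G c m W' → ∀ v ∈ W', ∃ φ, IsListTreeCopy G D k φ ∧ φ [] = v ∧
        ∀ l ∈ treeLists D k, φ l ∈ W')
    (hW : NoCreature G (c + n * (treeLists D k).ncard) m W) (hWU : W ⊆ U) {g : ℕ → V}
    (hgU : ∀ a < n, g a ∈ U) (hgW : ∀ a < n, g a ∉ W) (hg : ∀ a < n, ∀ b < n, g a = g b → a = b)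
    (hdeg : ∀ a < n, c + n * (treeLists D k).ncard ≤ (G.neighborSet (g a) ∩ W).ncard) :
    ∃ Φ : ℕ → List ℕ → V, (∀ a < n, IsListTreeCopy G D k (Φ a) ∧ Φ a [] = g a ∧
        ∀ l ∈ treeLists D k, Φ a l ∈ insert (g a) W) ∧
      ∀ a < n, ∀ b < n, a ≠ b → ∀ l ∈ treeLists D k, ∀ l' ∈ treeLists D k, Φ a l ≠ Φ b l' := by
  classical
  suffices H : ∀ j ≤ n, ∃ Φ : ℕ → List ℕ → V, (∀ a < j, IsListTreeCopy G D k (Φ a) ∧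
      Φ a [] = g a ∧ ∀ l ∈ treeLists D k, Φ a l ∈ insert (g a) W) ∧
      ∀ a < j, ∀ b < j, a ≠ b → ∀ l ∈ treeLists D k, ∀ l' ∈ treeLists D k, Φ a l ≠ Φ b l' from
    H n le_rfl
  intro j
  induction j with
  | zero =>
    exact fun _ => ⟨fun a _ => g a, by simp, by simp⟩
  | succ j ihj =>
    intro hj
    obtain ⟨Φ, hΦ, hdis⟩ := ihj (by omega)
    set s := (treeLists D k).ncard
    set F : Set V := (fun p : ℕ × List ℕ => Φ p.1 p.2) '' (Set.Iio j ×ˢ treeLists D k)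
    have hFcard : F.ncard ≤ n * s := by
      have hfin : (Set.Iio j ×ˢ treeLists D k).Finite :=
        (Set.finite_Iio j).prod (finite_treeLists D k)
      refine (Set.ncard_image_le hfin).trans ?_
      rw [Set.ncard_prod]
      have : (Set.Iio j).ncard = j := by
        rw [← Finset.coe_Iio, Set.ncard_coe_finset, Nat.card_Iio]
      rw [this]
      exact Nat.mul_le_mul_right _ (by omega)
    have hdegF : c ≤ (G.neighborSet (g j) ∩ (W \ F)).ncard := by
      have hsub : G.neighborSet (g j) ∩ W ⊆ (G.neighborSet (g j) ∩ (W \ F)) ∪ F := by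
        rintro x ⟨h1, h2⟩
        by_cases hx : x ∈ F
        · exact Or.inr hx
        · exact Or.inl ⟨h1, h2, hx⟩
      have h1 := Set.ncard_le_ncard hsub (Set.toFinite _)
      have h2 := Set.ncard_union_le (G.neighborSet (g j) ∩ (W \ F)) F
      have h3 := hdeg j (by omega)
      omega
    have hins : insert (g j) (W \ F) ⊆ U :=
      Set.insert_subset (hgU j (by omega)) (Set.sdiff_subset.trans hWU)
    obtain ⟨φ, hφ, hroot, hφW⟩ := ih (insert (g j) (W \ F))
      (fun v hv => (hloc v (hins hv)).mono (Set.inter_subset_inter_right _ hins))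
      ((hW.diff hFcard).insert hdegF) (g j) (Set.mem_insert _ _)
    have hgF : g j ∉ F := by
      rintro ⟨⟨a, l⟩, ⟨ha, hl⟩, hal⟩
      have ha' : a < j := ha
      rcases (hΦ a ha').2.2 l hl with h | h
      · have := hg j (by omega) a (by omega) (hal.symm.trans h)
        omega
      · simp only at hal
        rw [hal] at h
        exact hgW j (by omega) h
    have hφF : ∀ l ∈ treeLists D k, φ l ∉ F := by
      intro l hl
      rcases hφW l hl with h | h
      · rwa [h]
      · exact h.2
    have hne : ∀ a < j, ∀ l ∈ treeLists D k, ∀ l' ∈ treeLists D k, Φ a l ≠ φ l' :=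
      fun a ha l hl l' hl' h => hφF l' hl' ⟨(a, l), ⟨ha, hl⟩, h⟩
    refine ⟨fun a => if a < j then Φ a else φ, ?_, ?_⟩
    · intro a ha
      by_cases haj : a < j
      · simpa [haj] using hΦ a haj
      · obtain rfl : a = j := by omega
        simp only [lt_irrefl, if_false]
        exact ⟨hφ, hroot, fun l hl => Set.insert_subset_insert Set.sdiff_subset (hφW l hl)⟩
    · intro a ha b hb hab l hl l' hl'
      by_cases haj : a < j <;> by_cases hbj : b < j <;> simp only [haj, hbj, if_true, if_false]
      · exact hdis a haj b hbj hab l hl l' hl'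
      · exact hne a haj l hl l' hl'
      · exact (hne b hbj l' hl' l hl).symm
      · omega

/-- If neighbourhoods have bounded chromatic number and there are no creatures of bounded
chromatic number, then every vertex is the root of a path-induced tree. -/
lemma exists_copy_of_noCreature (D m₀ k : ℕ) :
    ∃ c m : ℕ, ∀ (V : Type*) [Finite V] (G : SimpleGraph V) (W : Set V),
      (∀ v ∈ W, ColorableOn G (G.neighborSet v ∩ W) m₀) → NoCreature G c m W →
      ∀ v ∈ W, ∃ φ, IsListTreeCopy G D k φ ∧ φ [] = v ∧ ∀ l ∈ treeLists D k, φ l ∈ W := by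
  classical
  induction k with
  | zero =>
    refine ⟨0, 0, fun V _ G W _ _ v hv => ⟨fun _ => v, ⟨?_, ?_⟩, rfl, fun _ _ => hv⟩⟩
    · rintro l ⟨h, -⟩ l' ⟨h', -⟩ -
      simp at h h'
      rw [h, h']
    · rintro l x ⟨h, -⟩
      simp at h
      simp [h.1]
  | succ k ih =>
    obtain ⟨c, m, ih⟩ := ih
    set c₁ := c + D * (treeLists D k).ncard
    refine ⟨c₁ + D, (1 + m₀) + m * c₁, fun V _ G W hloc hW v hv => ?_⟩
    obtain ⟨Z, hZ, hW', hZcol, hZdeg⟩ :=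
      exists_noCreature_diff G c₁ m (W \ insert v (G.neighborSet v))
    set W' := (W \ insert v (G.neighborSet v)) \ Z
    have hW'W : W' ⊆ W := Set.sdiff_subset.trans Set.sdiff_subset
    have hW'v : v ∉ W' := fun h => h.1.2 (Set.mem_insert _ _)
    have hW'N : ∀ x ∈ W', ¬ G.Adj v x := fun x h hx => h.1.2 (Set.mem_insert_of_mem _ hx)
    set B : Set V := {u ∈ G.neighborSet v ∩ W | c₁ ≤ (G.neighborSet u ∩ W').ncard}
    have hBcard : D ≤ B.ncard := by
      by_contra! hBD
      have hvB : v ∉ B := fun h => G.loopless.irrefl _ h.1.1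
      have hsub : (insert v (G.neighborSet v ∩ W) ∪ Z) \ B ⊆ W := by
        rintro x ⟨(rfl | hx) | hx, -⟩
        · exact hv
        · exact hx.2
        · exact (hZ hx).1
      refine hW _ hsub ⟨v, Or.inl (Set.mem_insert _ _), hvB⟩ ?_ ?_
      · rintro x ⟨hx, hxB⟩
        have hx' : (G.neighborSet x ∩ W').ncard < c₁ ∨ (G.neighborSet x ∩ W').ncard = 0 := by
          rcases hx with (rfl | hx) | hx
          · right
            rw [Set.ncard_eq_zero (Set.toFinite _)]
            ext y
            simp only [Set.mem_inter_iff, Set.mem_empty_iff_false, iff_false]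
            exact fun h => hW'N y h.2 h.1
          · left
            by_contra! h
            exact hxB ⟨hx, h⟩
          · exact Or.inl (hZdeg x hx)
        have hsub' : G.neighborSet x ∩ (W \ ((insert v (G.neighborSet v ∩ W) ∪ Z) \ B)) ⊆
            (G.neighborSet x ∩ W') ∪ B := by
          rintro y ⟨h1, h2, h3⟩
          by_cases hyB : y ∈ B
          · exact Or.inr hyB
          · refine Or.inl ⟨h1, ⟨h2, fun hy => h3 ⟨Or.inl ?_, hyB⟩⟩, fun hy => h3 ⟨Or.inr hy, hyB⟩⟩
            rcases hy with hy | hy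
            · exact Or.inl hy
            · exact Or.inr ⟨hy, h2⟩
        have h1 := Set.ncard_le_ncard hsub' (Set.toFinite _)
        have h2 := Set.ncard_union_le (G.neighborSet x ∩ W') B
        omega
      · refine ((((colorableOn_singleton G v).union (hloc v hv)).union hZcol).mono ?_)
        rw [Set.singleton_union]
        exact Set.sdiff_subset
    obtain ⟨B', hB'B, hB'card⟩ := Set.exists_subset_card_eq hBcard
    have hB'fin : B'.Finite := Set.toFinite _
    let e := (hB'fin.toFinset.equivFinOfCardEq
      (n := D) (by rw [← Set.ncard_eq_toFinset_card B' hB'fin, hB'card])).symm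
    let g : ℕ → V := fun a => if h : a < D then (e ⟨a, h⟩ : V) else v
    have hgB : ∀ a < D, g a ∈ B := by
      intro a ha
      simp only [g, ha, dif_pos]
      exact hB'B (hB'fin.mem_toFinset.1 (e ⟨a, ha⟩).2)
    have hginj : ∀ a < D, ∀ b < D, g a = g b → a = b := by
      intro a ha b hb h
      simp only [g, ha, hb, dif_pos] at h
      simpa using e.injective (Subtype.ext h)
    have hgW' : ∀ a < D, g a ∉ W' := fun a ha h => hW'N _ h (hgB a ha).1.1
    obtain ⟨Φ, hΦ, hdis⟩ := exists_disjoint_copies hloc (ih V G) hW' hW'W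
      (fun a ha => (hgB a ha).1.2) hgW' hginj (fun a ha => (hgB a ha).2)
    have hgv : ∀ a < D, G.Adj v (g a) := fun a ha => (hgB a ha).1.1
    refine ⟨_, IsListTreeCopy.join (v := v) (fun a ha => (hΦ a ha).1) ?_ ?_ hdis, by simp, ?_⟩
    · intro a ha l hl h
      rcases (hΦ a ha).2.2 l hl with h' | h'
      · exact (hgv a ha).ne (h.symm.trans h')
      · exact hW'v (h ▸ h')
    · intro a ha l hl
      constructor
      · intro h
        rcases (hΦ a ha).2.2 l hl with h' | h'
        · exact (hΦ a ha).1.injOn hl (mem_treeLists_of_append (l := l) (by simpa using hl))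
            (h'.trans (hΦ a ha).2.1.symm)
        · exact absurd h.symm (hW'N _ h')
      · rintro rfl
        rw [(hΦ a ha).2.1]
        exact (hgv a ha).symm
    · intro l hl
      rcases List.eq_nil_or_concat' l with rfl | ⟨l, a, rfl⟩
      · simpa using hv
      · have ha : a < D := hl.2 a (by simp)
        have hl' : l ∈ treeLists D k :=
          ⟨by simpa using hl.1, fun x hx => hl.2 x (by simp [hx])⟩
        have := (hΦ a ha).2.2 l hl'
        simp only [List.append_eq_nil_iff, List.cons_ne_self, and_false, dif_neg,
          not_false_eq_true, List.getLast_append_singleton, List.dropLast_concat]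
        rcases this with h | h
        · rw [h]; exact (hgB a ha).1.2
        · exact hW'W h

/-- A graph with no `t`-clique and large chromatic number has a path-induced copy of a tree. -/
lemma exists_copy_of_cliqueFreeOn (D k t : ℕ) :
    ∃ c : ℕ, ∀ (V : Type*) [Finite V] (G : SimpleGraph V) (S : Set V),
      G.CliqueFreeOn S t → ¬ ColorableOn G S c → ∃ φ, IsListTreeCopy G D k φ := by
  induction t with
  | zero =>
    refine ⟨0, fun V _ G S hS => ?_⟩
    exact absurd hS (by simp [SimpleGraph.CliqueFreeOn, SimpleGraph.isNClique_iff])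
  | succ t ih =>
    obtain ⟨m₀, ih⟩ := ih
    obtain ⟨c, m, h⟩ := exists_copy_of_noCreature D m₀ k
    refine ⟨m * c, fun V _ G S hS hcol => ?_⟩
    by_cases hloc : ∀ v ∈ S, ColorableOn G (G.neighborSet v ∩ S) m₀
    · obtain ⟨Z, hZ, hcf, hZcol, -⟩ := exists_noCreature_diff G c m S
      have hne : (S \ Z).Nonempty := by
        by_contra hcon
        rw [Set.not_nonempty_iff_eq_empty, Set.sdiff_eq_empty] at hcon
        exact hcol (hZcol.mono hcon)
      obtain ⟨v, hv⟩ := hne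
      obtain ⟨φ, hφ, -⟩ := h V G (S \ Z) (fun v hv => (hloc v hv.1).mono
        (Set.inter_subset_inter_right _ Set.sdiff_subset)) hcf v hv
      exact ⟨φ, hφ⟩
    · push Not at hloc
      obtain ⟨v, hv, hcolv⟩ := hloc
      refine ih V G _ ?_ hcolv
      classical
      intro K hK hKcl
      refine hS (t := insert v K) ?_ (hKcl.insert fun b hb => (hK hb).1)
      rw [Finset.coe_insert]
      exact Set.insert_subset hv fun x hx => (hK hx).2

/-- Strictly decreasing lists of length `M` with entries in `H`. -/
def decreasingLists (H : Finset ℕ) (M : ℕ) : Set (List ℕ) :=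
  {l | l.length = M ∧ l.Pairwise (· > ·) ∧ ∀ x ∈ l, x ∈ H}

lemma decreasingLists_mono {H H' : Finset ℕ} (h : H ⊆ H') (M : ℕ) :
    decreasingLists H M ⊆ decreasingLists H' M :=
  fun _ hl => ⟨hl.1, hl.2.1, fun x hx => h (hl.2.2 x hx)⟩

/-- The finite hypergraph Ramsey theorem for two colours. -/
lemma exists_ramsey (M N : ℕ) : ∃ D : ℕ, ∀ (P : List ℕ → Prop) (S : Finset ℕ), D ≤ S.card →
    ∃ H ⊆ S, N ≤ H.card ∧ ∃ q : Prop, ∀ l ∈ decreasingLists H M, P l ↔ q := by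
  classical
  induction M generalizing N with
  | zero =>
    refine ⟨N, fun P S hS => ⟨S, subset_rfl, hS, P [], fun l hl => ?_⟩⟩
    rw [List.length_eq_zero_iff.1 hl.1]
  | succ M ih =>
    have hpre : ∀ n, ∃ D : ℕ, ∀ (P : List ℕ → Prop) (S : Finset ℕ), D ≤ S.card →
        ∃ H ⊆ S, n ≤ H.card ∧ ∃ Q : ℕ → Prop, ∀ x l, x :: l ∈ decreasingLists H (M + 1) →
          (P (x :: l) ↔ Q x) := by
      intro n
      induction n with
      | zero =>
        refine ⟨0, fun P S _ => ⟨∅, by simp, by simp, fun _ => True, fun x l hl => ?_⟩⟩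
        simpa using hl.2.2 x (by simp)
      | succ n ihn =>
        obtain ⟨D₁, h₁⟩ := ihn
        obtain ⟨D₂, h₂⟩ := ih D₁
        refine ⟨D₂ + 1, fun P S hS => ?_⟩
        have hne : S.Nonempty := Finset.card_pos.1 (by omega)
        set x := S.max' hne
        have hx : x ∈ S := S.max'_mem hne
        obtain ⟨H₂, hH₂, hc₂, q, hq⟩ := h₂ (fun l => P (x :: l)) (S.erase x)
          (by rw [Finset.card_erase_of_mem hx]; omega)
        obtain ⟨H₁, hH₁, hc₁, Q, hQ⟩ := h₁ P H₂ hc₂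
        have hlt : ∀ y ∈ H₁, y < x := by
          intro y hy
          have hy' := hH₂ (hH₁ hy)
          exact lt_of_le_of_ne (S.le_max' y (Finset.mem_of_mem_erase hy'))
            (Finset.ne_of_mem_erase hy')
        have hxH : x ∉ H₁ := fun h => lt_irrefl _ (hlt x h)
        refine ⟨insert x H₁, ?_, ?_, fun y => if y = x then q else Q y, ?_⟩
        · exact Finset.insert_subset hx (hH₁.trans (hH₂.trans (Finset.erase_subset _ _)))
        · rw [Finset.card_insert_of_notMem hxH]; omega
        · rintro y l ⟨h1, h2, h3⟩
          have hyx : y ≤ x := by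
            rcases Finset.mem_insert.1 (h3 y (by simp)) with h | h
            · exact h.le
            · exact (hlt y h).le
          have hl : ∀ z ∈ l, z ∈ H₁ := by
            intro z hz
            have := List.rel_of_pairwise_cons h2 hz
            exact (Finset.mem_insert.1 (h3 z (by simp [hz]))).resolve_left (by omega)
          by_cases hyx' : y = x
          · subst hyx'
            simpa using hq l ⟨by simpa using h1, (List.pairwise_cons.1 h2).2,
              fun z hz => hH₁ (hl z hz)⟩
          · simp only [hyx', if_false]
            refine hQ y l ⟨h1, h2, fun z hz => ?_⟩
            rcases List.mem_cons.1 hz with rfl | hz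
            · exact (Finset.mem_insert.1 (h3 z (by simp))).resolve_left hyx'
            · exact hl z hz
    obtain ⟨D, hD⟩ := hpre (N + N)
    refine ⟨D, fun P S hS => ?_⟩
    obtain ⟨H, hHS, hcard, Q, hQ⟩ := hD P S hS
    have hsum := Finset.card_filter_add_card_filter_not (s := H) Q
    have hsplit : N ≤ (H.filter Q).card ∨ N ≤ (H.filter fun x => ¬ Q x).card := by omega
    rcases hsplit with h | h
    · refine ⟨_, (Finset.filter_subset _ _).trans hHS, h, True, fun l hl => ?_⟩
      obtain ⟨x, l, rfl⟩ := List.exists_cons_of_length_eq_add_one hl.1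
      rw [hQ x l (decreasingLists_mono (Finset.filter_subset _ _) _ hl)]
      simpa using (Finset.mem_filter.1 (hl.2.2 x (by simp))).2
    · refine ⟨_, (Finset.filter_subset _ _).trans hHS, h, False, fun l hl => ?_⟩
      obtain ⟨x, l, rfl⟩ := List.exists_cons_of_length_eq_add_one hl.1
      rw [hQ x l (decreasingLists_mono (Finset.filter_subset _ _) _ hl)]
      simpa using (Finset.mem_filter.1 (hl.2.2 x (by simp))).2

/-- The Ramsey theorem for finitely many colourings of lists of different lengths. -/
lemma exists_ramsey_family {ι : Type*} (I : List ι) (M : ι → ℕ) (N : ℕ) :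
    ∃ D : ℕ, ∀ (P : ι → List ℕ → Prop) (S : Finset ℕ), D ≤ S.card →
      ∃ H ⊆ S, N ≤ H.card ∧ ∀ i ∈ I, ∃ q : Prop, ∀ l ∈ decreasingLists H (M i), P i l ↔ q := by
  induction I with
  | nil => exact ⟨N, fun P S hS => ⟨S, subset_rfl, hS, by simp⟩⟩
  | cons i I ih =>
    obtain ⟨D₁, h₁⟩ := ih
    obtain ⟨D₂, h₂⟩ := exists_ramsey (M i) D₁
    refine ⟨D₂, fun P S hS => ?_⟩
    obtain ⟨H₂, hH₂, hc₂, q, hq⟩ := h₂ (P i) S hS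
    obtain ⟨H₁, hH₁, hc₁, h⟩ := h₁ P H₂ hc₂
    refine ⟨H₁, hH₁.trans hH₂, hc₁, fun j hj => ?_⟩
    rcases List.mem_cons.1 hj with rfl | hj
    · exact ⟨q, fun l hl => hq l (decreasingLists_mono hH₁ _ hl)⟩
    · exact h j hj

/-- A number for each vertex of the tree of height `k`, compatible with the preorder, when
labels are less than `B - 1`. -/
def preorderIndex (B k : ℕ) : List ℕ → ℕ
  | [] => 0
  | a :: l => preorderIndex B k l + (a + 1) * B ^ (k - (l.length + 1))

/-- The preorder indices of a vertex and its ancestors. -/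
def preorderPath (B k : ℕ) : List ℕ → List ℕ
  | [] => []
  | a :: l => preorderIndex B k (a :: l) :: preorderPath B k l

lemma length_preorderPath (B k : ℕ) (l : List ℕ) : (preorderPath B k l).length = l.length := by
  induction l with
  | nil => rfl
  | cons a l ih => simp [preorderPath, ih]

lemma preorderIndex_cons_add_le {d k a b : ℕ} {l : List ℕ} (hab : a < b) :
    preorderIndex (d + 1) k (a :: l) + (d + 1) ^ (k - (l.length + 1)) ≤
      preorderIndex (d + 1) k (b :: l) := by
  simp only [preorderIndex]
  have : (a + 1 + 1) * (d + 1) ^ (k - (l.length + 1)) ≤ (b + 1) * (d + 1) ^ (k - (l.length + 1)) :=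
    Nat.mul_le_mul_right _ (by omega)
  linarith

lemma preorderIndex_cons_add_le_self {d k a : ℕ} {l : List ℕ} (hl : l.length + 1 ≤ k)
    (ha : a < d) :
    preorderIndex (d + 1) k (a :: l) + (d + 1) ^ (k - (l.length + 1)) ≤
      preorderIndex (d + 1) k l + (d + 1) ^ (k - l.length) := by
  have hk : k - l.length = k - (l.length + 1) + 1 := by omega
  rw [hk, pow_succ]
  simp only [preorderIndex]
  have : (a + 1 + 1) * (d + 1) ^ (k - (l.length + 1)) ≤ (d + 1) * (d + 1) ^ (k - (l.length + 1)) :=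
    Nat.mul_le_mul_right _ (by omega)
  linarith

lemma preorderIndex_lt_cons (d k a : ℕ) (l : List ℕ) :
    preorderIndex (d + 1) k l < preorderIndex (d + 1) k (a :: l) := by
  simp only [preorderIndex]
  have : 0 < (a + 1) * (d + 1) ^ (k - (l.length + 1)) := by positivity
  omega

/-- The indices of the descendants of `x` lie in an interval starting at the index of `x`. -/
lemma exists_preorderPath_append {d k : ℕ} (y x : List ℕ) (h : y ++ x ∈ treeLists d k) :
    ∃ τ : List ℕ, preorderPath (d + 1) k (y ++ x) = τ ++ preorderPath (d + 1) k x ∧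
      τ.length = y.length ∧ τ.Pairwise (· > ·) ∧
      (∀ n ∈ τ, preorderIndex (d + 1) k x < n ∧ n ≤ preorderIndex (d + 1) k (y ++ x)) ∧
      preorderIndex (d + 1) k x ≤ preorderIndex (d + 1) k (y ++ x) ∧
      preorderIndex (d + 1) k (y ++ x) + (d + 1) ^ (k - (y ++ x).length) ≤
        preorderIndex (d + 1) k x + (d + 1) ^ (k - x.length) := by
  induction y with
  | nil => exact ⟨[], by simp⟩
  | cons a y ih =>
    have hd := mem_treeLists_of_append (l := [a]) (by simpa using h)
    obtain ⟨τ, h1, h2, h3, h4, h5, h6⟩ := ih hd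
    have hlt := preorderIndex_lt_cons d k a (y ++ x)
    have hle := preorderIndex_cons_add_le_self (d := d) (k := k) (a := a) (l := y ++ x)
      (by simpa using h.1) (h.2 a (by simp))
    refine ⟨preorderIndex (d + 1) k (a :: (y ++ x)) :: τ, ?_, by simp [h2], ?_, ?_, ?_, ?_⟩
    · simp [preorderPath, h1]
    · exact List.pairwise_cons.2 ⟨fun n hn => lt_of_le_of_lt (h4 n hn).2 hlt, h3⟩
    · intro n hn
      rcases List.mem_cons.1 hn with rfl | hn
      · exact ⟨h5.trans_lt hlt, le_rfl⟩
      · exact ⟨(h4 n hn).1, (h4 n hn).2.trans hlt.le⟩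
    · exact h5.trans hlt.le
    · simpa using hle.trans h6

lemma pairwise_preorderPath {d k : ℕ} {l : List ℕ} (h : l ∈ treeLists d k) :
    (preorderPath (d + 1) k l).Pairwise (· > ·) := by
  obtain ⟨τ, h1, -, h3, -⟩ := exists_preorderPath_append l [] (by simpa using h)
  simp only [List.append_nil, preorderPath] at h1
  rwa [h1]

lemma lt_of_mem_preorderPath {d k n : ℕ} {l : List ℕ} (h : l ∈ treeLists d k)
    (hn : n ∈ preorderPath (d + 1) k l) : n < (d + 1) ^ k := by
  obtain ⟨τ, h1, -, -, h4, -, h6⟩ := exists_preorderPath_append l [] (by simpa using h)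
  simp only [List.append_nil, preorderPath] at h1
  rw [h1] at hn
  have := (h4 n hn).2
  simp only [List.append_nil, preorderIndex, List.length_nil] at this h6
  have : 0 < (d + 1) ^ (k - l.length) := by positivity
  simp only [zero_add, Nat.sub_zero] at h6
  omega

lemma preorderPath_injective (d k : ℕ) : Function.Injective (preorderPath (d + 1) k) := by
  intro l
  induction l with
  | nil =>
    rintro (_ | ⟨b, l'⟩) h
    · rfl
    · simp [preorderPath] at h
  | cons a l ih =>
    rintro (_ | ⟨b, l'⟩) h
    · simp [preorderPath] at h
    · simp only [preorderPath, List.cons.injEq] at h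
      obtain rfl := ih h.2
      have h1 := h.1
      simp only [preorderIndex, Nat.add_left_cancel_iff] at h1
      have := Nat.eq_of_mul_eq_mul_right (by positivity) h1
      simp only [List.cons.injEq, and_true]
      omega

/-- The preorder paths of an earlier and a later vertex are the parts of a decreasing list. -/
lemma exists_preorderPath_pair {d k i j : ℕ} {y z w : List ℕ} (hij : i < j)
    (hy : y ++ i :: w ∈ treeLists d k) (hz : z ++ j :: w ∈ treeLists d k) :
    ∃ Y Z : List ℕ, Y.length = y.length + 1 ∧ Z.length = z.length + 1 ∧
      preorderPath (d + 1) k (y ++ i :: w) = Y ++ preorderPath (d + 1) k w ∧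
      preorderPath (d + 1) k (z ++ j :: w) = Z ++ preorderPath (d + 1) k w ∧
      (Z ++ (Y ++ preorderPath (d + 1) k w)).Pairwise (· > ·) := by
  obtain ⟨τ, h1, h2, -, h4, h5, h6⟩ := exists_preorderPath_append y (i :: w) hy
  obtain ⟨ρ, g1, g2, -, g4, g5, g6⟩ := exists_preorderPath_append z (j :: w) hz
  have hpy := pairwise_preorderPath hy
  have hpz := pairwise_preorderPath hz
  have e1 : preorderPath (d + 1) k (y ++ i :: w) =
      (τ ++ [preorderIndex (d + 1) k (i :: w)]) ++ preorderPath (d + 1) k w := by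
    rw [h1]; simp [preorderPath]
  have e2 : preorderPath (d + 1) k (z ++ j :: w) =
      (ρ ++ [preorderIndex (d + 1) k (j :: w)]) ++ preorderPath (d + 1) k w := by
    rw [g1]; simp [preorderPath]
  refine ⟨_, _, by simp [h2], by simp [g2], e1, e2, ?_⟩
  rw [e1] at hpy
  rw [e2] at hpz
  have hle := preorderIndex_cons_add_le (d := d) (k := k) (l := w) hij
  have hpos : 0 < (d + 1) ^ (k - (y ++ i :: w).length) := by positivity
  have hYlt : ∀ n ∈ τ ++ [preorderIndex (d + 1) k (i :: w)],
      n < preorderIndex (d + 1) k (j :: w) := by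
    intro n hn
    simp only [List.length_cons] at h6
    rcases List.mem_append.1 hn with hn | hn
    · have := (h4 n hn).2
      omega
    · rw [List.mem_singleton.1 hn]
      omega
  have hZle : ∀ n ∈ ρ ++ [preorderIndex (d + 1) k (j :: w)],
      preorderIndex (d + 1) k (j :: w) ≤ n := by
    intro n hn
    rcases List.mem_append.1 hn with hn | hn
    · exact (g4 n hn).1.le
    · rw [List.mem_singleton.1 hn]
  rw [List.pairwise_append] at hpz ⊢
  refine ⟨hpz.1, hpy, fun a ha b hb => ?_⟩
  rcases List.mem_append.1 hb with hb | hb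
  · exact (hYlt b hb).trans_le (hZle a ha)
  · exact hpz.2.2 a ha b hb

/-- Every relation on the vertices of a tree with large branching is type-uniform on a subtree. -/
lemma exists_uniform_subtree (d k : ℕ) : ∃ D : ℕ, ∀ A : List ℕ → List ℕ → Prop,
    ∃ σ : List ℕ → List ℕ, (∀ l ∈ treeLists d k, σ l ∈ treeLists D k) ∧
      Set.InjOn σ (treeLists d k) ∧
      (∀ l x, l ++ x ∈ treeLists d k → ∃ τ, σ (l ++ x) = τ ++ σ x ∧ τ.length = l.length) ∧
      ∀ α β γ, ∃ q : Prop, ∀ y i z j w, y.length = α → z.length = β → w.length = γ → i < j →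
        y ++ i :: w ∈ treeLists d k → z ++ j :: w ∈ treeLists d k →
        (A (σ (y ++ i :: w)) (σ (z ++ j :: w)) ↔ q) := by
  classical
  let I : List (ℕ × ℕ × ℕ) :=
    (Finset.range k ×ˢ Finset.range k ×ˢ Finset.range k).toList
  obtain ⟨D, hD⟩ := exists_ramsey_family I (fun p => p.1 + p.2.1 + 2 + p.2.2) ((d + 1) ^ k)
  refine ⟨D, fun A => ?_⟩
  obtain ⟨H, hHD, hcard, hH⟩ := hD (fun p L => A (L.drop (p.2.1 + 1))
    (L.take (p.2.1 + 1) ++ L.drop (p.2.1 + 1 + (p.1 + 1)))) (Finset.range D) (by simp)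
  let h : ℕ → ℕ := fun n => if hn : n < (d + 1) ^ k then H.orderEmbOfCardLe hcard ⟨n, hn⟩ else D + n
  have hmem : ∀ n < (d + 1) ^ k, h n ∈ H := by
    intro n hn
    simp only [h, hn, dif_pos]
    exact H.orderEmbOfCardLe_mem hcard _
  have hmono : StrictMono h := by
    intro m n hmn
    by_cases hn : n < (d + 1) ^ k
    · simp only [h, hn, hmn.trans hn, dif_pos]
      exact (H.orderEmbOfCardLe hcard).strictMono hmn
    · by_cases hm : m < (d + 1) ^ k
      · have := Finset.mem_range.1 (hHD (hmem m hm))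
        have : h n = D + n := dif_neg hn
        omega
      · simp only [h, hn, hm, dif_neg, not_false_eq_true]
        omega
  have hmemPath : ∀ l ∈ treeLists d k, ∀ x ∈ (preorderPath (d + 1) k l).map h, x ∈ H := by
    intro l hl x hx
    obtain ⟨n, hn, rfl⟩ := List.mem_map.1 hx
    exact hmem n (lt_of_mem_preorderPath hl hn)
  refine ⟨fun l => (preorderPath (d + 1) k l).map h, ?_, ?_, ?_, ?_⟩
  · exact fun l hl => ⟨by simpa [length_preorderPath] using hl.1,
      fun x hx => Finset.mem_range.1 (hHD (hmemPath l hl x hx))⟩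
  · exact ((List.map_injective_iff.2 hmono.injective).comp (preorderPath_injective d k)).injOn
  · intro l x hl
    obtain ⟨τ, h1, h2, -⟩ := exists_preorderPath_append l x hl
    exact ⟨τ.map h, by simp [h1], by simp [h2]⟩
  · intro α β γ
    by_cases hαβγ : α < k ∧ β < k ∧ γ < k
    · obtain ⟨q, hq⟩ := hH (α, β, γ) (by simpa [I] using hαβγ)
      refine ⟨q, fun y i z j w hy hz hw hij hyt hzt => ?_⟩
      obtain ⟨Y, Z, hY, hZ, eY, eZ, hpw⟩ := exists_preorderPath_pair hij hyt hzt
      have hlen := length_preorderPath (d + 1) k w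
      have hbd : ∀ n ∈ Z ++ (Y ++ preorderPath (d + 1) k w), n < (d + 1) ^ k := by
        intro n hn
        rcases List.mem_append.1 hn with hn | hn
        · exact lt_of_mem_preorderPath hzt (by rw [eZ]; exact List.mem_append_left _ hn)
        · exact lt_of_mem_preorderPath hyt (by rwa [eY])
      have := hq ((Z ++ (Y ++ preorderPath (d + 1) k w)).map h) ⟨?_, ?_, ?_⟩
      · rw [← this]
        have hZ' : (Z.map h).length = β + 1 := by simp [hZ, hz]
        have hY' : (Y.map h).length = α + 1 := by simp [hY, hy]
        simp only [eY, eZ, List.map_append]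
        rw [List.drop_left' hZ', List.take_left' hZ', ← List.drop_drop, List.drop_left' hZ',
          List.drop_left' hY']
      · simp only [List.length_map, List.length_append]; omega
      · rw [List.pairwise_map]
        exact hpw.imp fun hab => hmono hab
      · intro x hx
        obtain ⟨n, hn, rfl⟩ := List.mem_map.1 hx
        exact hmem n (hbd n hn)
    · refine ⟨True, fun y i z j w hy hz hw _ hyt hzt => absurd ?_ hαβγ⟩
      have h1 := hyt.1
      have h2 := hzt.1
      simp only [List.length_append, List.length_cons] at h1 h2
      omega

/-- Path-induced copies can be pulled back along embeddings of trees preserving levels. -/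
lemma IsListTreeCopy.comp {V : Type*} {G : SimpleGraph V} {D d k : ℕ} {φ : List ℕ → V}
    (hφ : IsListTreeCopy G D k φ) {σ : List ℕ → List ℕ}
    (hσ : ∀ l ∈ treeLists d k, σ l ∈ treeLists D k) (hinj : Set.InjOn σ (treeLists d k))
    (happ : ∀ l x, l ++ x ∈ treeLists d k → ∃ τ, σ (l ++ x) = τ ++ σ x ∧ τ.length = l.length) :
    IsListTreeCopy G d k (φ ∘ σ) := by
  refine ⟨hφ.injOn.comp hinj hσ, fun l x hl => ?_⟩
  obtain ⟨τ, h1, h2⟩ := happ l x hl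
  have h := hφ.adj_iff τ (σ x) (h1 ▸ hσ _ hl)
  rw [← h2, ← h]
  simp only [Function.comp, h1]

lemma IsListTreeCopy.adj_drop_iff {V : Type*} {G : SimpleGraph V} {d k : ℕ} {ψ : List ℕ → V}
    (hψ : IsListTreeCopy G d k ψ) {v : List ℕ} (hv : v ∈ treeLists d k) {i j : ℕ}
    (hi : i ≤ v.length) (hj : j ≤ v.length) :
    G.Adj (ψ (v.drop (v.length - i))) (ψ (v.drop (v.length - j))) ↔ i + 1 = j ∨ j + 1 = i := by
  wlog hij : i ≤ j generalizing i j
  · rw [G.adj_comm, this hj hi (by omega), or_comm]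
  have hsplit : v.drop (v.length - j) =
      (v.drop (v.length - j)).take (j - i) ++ v.drop (v.length - i) := by
    conv_lhs => rw [← List.take_append_drop (j - i) (v.drop (v.length - j)), List.drop_drop]
    congr 2
    omega
  have hmem : v.drop (v.length - j) ∈ treeLists d k :=
    mem_treeLists_of_append (l := v.take (v.length - j)) (by simpa using hv)
  have h := hψ.adj_iff ((v.drop (v.length - j)).take (j - i)) (v.drop (v.length - i))
    (hsplit ▸ hmem)
  rw [← hsplit] at h
  rw [G.adj_comm, h]
  simp only [List.length_take, List.length_drop]
  omega

lemma tdk_adj_iff {d k : ℕ} {u v : TdkVertex d k} :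
    (Tdk d k).Adj u v ↔ (∃ a, v.val = a :: u.val) ∨ ∃ a, u.val = a :: v.val := by
  rw [Tdk, SimpleGraph.fromRel_adj]
  refine ⟨fun h => h.2, fun h => ⟨?_, h⟩⟩
  rintro rfl
  rcases h with ⟨a, ha⟩ | ⟨a, ha⟩ <;> simpa using congrArg List.length ha

/-- The vertices of a path of `T_d^k` starting at the root are the ancestors of its end. -/
lemma map_val_support_of_isPath {d k : ℕ} {u v : TdkVertex d k} (p : (Tdk d k).Walk u v)
    (hu : u = TdkRoot d k) (hp : p.IsPath) :
    p.support.map (fun x : TdkVertex d k => x.val) = v.val.tails.reverse := by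
  induction p using SimpleGraph.Walk.concatRec with
  | Hnil =>
    subst hu
    rfl
  | @Hconcat u w v q h ih =>
    have hpath : q.IsPath ∧ v ∉ q.support := by
      rw [SimpleGraph.Walk.isPath_def, SimpleGraph.Walk.support_concat,
        List.nodup_append] at hp
      refine ⟨(SimpleGraph.Walk.isPath_def _).2 hp.1, fun hv => ?_⟩
      exact hp.2.2 v hv v (by simp) rfl
    have ih := ih hu hpath.1
    rcases tdk_adj_iff.1 h with ⟨a, ha⟩ | ⟨a, ha⟩
    · rw [SimpleGraph.Walk.support_concat]
      simp [ih, ha]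
    · exfalso
      have hmem : v.val ∈ q.support.map (fun x : TdkVertex d k => x.val) := by
        rw [ih, List.mem_reverse, List.mem_tails, ha]
        exact List.suffix_cons _ _
      obtain ⟨x, hx, hxv⟩ := List.mem_map.1 hmem
      exact hpath.2 (Subtype.ext hxv ▸ hx)

lemma TdkVertex.mem_treeLists {d d' k : ℕ} (hd : d ≤ d') (v : TdkVertex d k) :
    v.val ∈ treeLists d' k :=
  ⟨v.2.1, fun x hx => (v.2.2.1 x hx).trans_le hd⟩

/-- A path-induced copy indexed by lists restricts to a copy of `T_d^k`. -/
lemma IsListTreeCopy.exists_isPathInducedCopy {V : Type*} {G : SimpleGraph V} {d d' k : ℕ}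
    {ψ : List ℕ → V} (hψ : IsListTreeCopy G d' k ψ) (hd : d ≤ d') :
    ∃ φ : Tdk d k →g G, (∀ v, φ v = ψ v.val) ∧
      IsPathInducedCopy (Tdk d k) (TdkRoot d k) G φ := by
  have hadj : ∀ u v : TdkVertex d k, (∃ a, v.val = a :: u.val) →
      G.Adj (ψ v.val) (ψ u.val) := by
    rintro u v ⟨a, ha⟩
    have h := hψ.adj_iff [a] u.val (by simpa [← ha] using v.mem_treeLists hd)
    simpa [← ha] using h
  let φ : Tdk d k →g G := ⟨fun v => ψ v.val, fun {u v} h => by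
    rcases tdk_adj_iff.1 h with h | h
    · exact (hadj _ _ h).symm
    · exact hadj _ _ h⟩
  have hinj : Function.Injective φ := fun u v h =>
    Subtype.ext (hψ.injOn (u.mem_treeLists hd) (v.mem_treeLists hd) h)
  refine ⟨φ, fun _ => rfl, hinj, fun v p hp => ⟨hp.map hinj, ?_⟩⟩
  have hsupp := map_val_support_of_isPath p rfl hp
  have hmap : (p.map φ).support = v.val.tails.reverse.map ψ := by
    rw [SimpleGraph.Walk.support_map, ← hsupp, List.map_map]
    rfl
  have hlen : (p.map φ).support.length = v.val.length + 1 := by simp [hmap]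
  have hget : ∀ i : Fin (p.map φ).support.length,
      (p.map φ).support.get i = ψ (v.val.drop (v.val.length - i)) := by
    intro i
    simp [hmap, List.getElem_tails]
  intro i j
  rw [hget, hget]
  exact hψ.adj_drop_iff (v.mem_treeLists hd) (by omega) (by omega)

lemma exists_append_cons_of_not_isPrefix (a b : List ℕ) (hab : ¬ a <+: b) (hba : ¬ b <+: a) :
    ∃ w i y j z, a = w ++ i :: y ∧ b = w ++ j :: z ∧ i ≠ j := by
  induction a generalizing b with
  | nil => exact absurd ⟨_, List.nil_append _⟩ hab
  | cons i a ih =>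
    rcases b with _ | ⟨j, b⟩
    · exact absurd ⟨_, List.nil_append _⟩ hba
    by_cases hij : i = j
    · subst hij
      obtain ⟨w, i', y, j', z, rfl, rfl, h⟩ := ih b (fun h => hab ((List.prefix_cons_inj i).2 h))
        (fun h => hba ((List.prefix_cons_inj i).2 h))
      exact ⟨i :: w, i', y, j', z, rfl, rfl, h⟩
    · exact ⟨[], i, a, j, b, rfl, rfl, hij⟩

lemma Incomp.exists_join {u v : List ℕ} (h : Incomp u v) :
    ∃ y i z j w, u = y ++ i :: w ∧ v = z ++ j :: w ∧ i ≠ j := by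
  obtain ⟨w, i, y, j, z, hu, hv, hij⟩ := exists_append_cons_of_not_isPrefix u.reverse v.reverse
    (fun h' => h.1 (List.reverse_prefix.1 h')) (fun h' => h.2 (List.reverse_prefix.1 h'))
  refine ⟨y.reverse, i, z.reverse, j, w.reverse, ?_, ?_, hij⟩
  · rw [← List.reverse_reverse u, hu]; simp
  · rw [← List.reverse_reverse v, hv]; simp

lemma incomp_of_length_eq {u v : List ℕ} (h : u.length = v.length) (hne : u ≠ v) : Incomp u v :=
  ⟨fun h' => hne (h'.eq_of_length h), fun h' => hne (h'.eq_of_length h.symm).symm⟩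

lemma lcsLen_append_cons {y z w : List ℕ} {i j : ℕ} (hij : i ≠ j) :
    lcsLen (y ++ i :: w) (z ++ j :: w) = w.length := by
  have key : ∀ (x a b : List ℕ), (((x ++ i :: a).zip (x ++ j :: b)).takeWhile
      (fun p => p.1 == p.2)).length = x.length := by
    intro x a b
    induction x with
    | nil => simp [hij]
    | cons c x ih => simpa using ih
  simpa [lcsLen] using key w.reverse y.reverse z.reverse

lemma branchLabel_append_cons {y z w : List ℕ} {i j : ℕ} (hij : i ≠ j) :
    branchLabel (y ++ i :: w) (z ++ j :: w) = i := by
  rw [branchLabel, lcsLen_append_cons hij]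
  have : (y ++ i :: w).length - w.length - 1 = y.length := by
    simp only [List.length_append, List.length_cons]; omega
  rw [this]
  simp

/-- In a graph with no `t`-clique, if adjacency between the images of incomparable vertices of a
tree with enough branching depends only on their type, then the levels are stable. -/
lemma not_adj_of_length_eq_of_typeUniform {V : Type*} {G : SimpleGraph V} {d k t : ℕ}
    {ψ : List ℕ → V} (ht : t ≤ d) (hG : G.CliqueFree t)
    (huni : ∀ α β γ, ∃ q : Prop, ∀ y i z j w, y.length = α → z.length = β → w.length = γ → i < j →
      y ++ i :: w ∈ treeLists d k → z ++ j :: w ∈ treeLists d k →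
      (G.Adj (ψ (y ++ i :: w)) (ψ (z ++ j :: w)) ↔ q))
    {u v : List ℕ} (hu : u ∈ treeLists d k) (hv : v ∈ treeLists d k)
    (huv : u.length = v.length) : ¬ G.Adj (ψ u) (ψ v) := by
  classical
  intro hadj
  have hne : u ≠ v := by rintro rfl; exact G.loopless.irrefl _ hadj
  obtain ⟨y, i, z, j, w, rfl, rfl, hij⟩ := (incomp_of_length_eq huv hne).exists_join
  have hyz : y.length = z.length := by simpa using huv
  obtain ⟨q, hq⟩ := huni y.length z.length w.length
  have hqt : q := by
    rcases lt_or_gt_of_ne hij with h | h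
    · exact (hq y i z j w rfl rfl rfl h hu hv).1 hadj
    · exact (hq z j y i w hyz.symm hyz rfl h hv hu).1 hadj.symm
  have hi : i < d := hu.2 i (by simp)
  let f : ℕ → List ℕ := fun n => List.replicate y.length 0 ++ n :: List.replicate w.length 0
  have hf : ∀ n < d, f n ∈ treeLists d k := by
    refine fun n hn => ⟨by simpa [f] using hu.1, fun x hx => ?_⟩
    simp only [f, List.mem_append, List.mem_cons, List.mem_replicate] at hx
    omega
  have hcl : ∀ m n, m < n → n < d → G.Adj (ψ (f m)) (ψ (f n)) := fun m n hmn hn =>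
    (hq (List.replicate y.length 0) m (List.replicate y.length 0) n (List.replicate w.length 0)
      (by simp) (by simp [hyz]) (by simp) hmn (hf m (hmn.trans hn)) (hf n hn)).2 hqt
  have hadj' : ∀ m < d, ∀ n < d, m ≠ n → G.Adj (ψ (f m)) (ψ (f n)) := by
    intro m hm n hn hmn
    rcases lt_or_gt_of_ne hmn with h | h
    · exact hcl m n h hn
    · exact (hcl n m h hm).symm
  refine hG ((Finset.range t).image fun n => ψ (f n)) ⟨?_, ?_⟩
  · intro a ha b hb hab
    simp only [Finset.coe_image, Finset.coe_range, Set.mem_image, Set.mem_Iio] at ha hb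
    obtain ⟨m, hm, rfl⟩ := ha
    obtain ⟨n, hn, rfl⟩ := hb
    exact hadj' m (hm.trans_le ht) n (hn.trans_le ht) (fun h => hab (by rw [h]))
  · rw [Finset.card_image_of_injOn, Finset.card_range]
    intro m hm n hn hmn
    by_contra hcon
    simp only [Finset.coe_range, Set.mem_Iio] at hm hn
    exact (hadj' m (hm.trans_le ht) n (hn.trans_le ht) hcon).ne hmn

/-- For all `k, t ≥ 1` and `d ≥ 2` there is a constant `c` such that every graph with no
clique of size `t` and chromatic number greater than `c` admits a path-induced,
level-stable, type-uniform copy of `(T_d^k, r)`. -/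
theorem type_uniform_copy (k t d : ℕ) (hk : 1 ≤ k) (ht : 1 ≤ t) (hd : 2 ≤ d) :
    ∃ c : ℕ, ∀ (V : Type) [Fintype V] (G : SimpleGraph V),
      G.CliqueFree t → (c : ℕ∞) < G.chromaticNumber →
      ∃ φ : Tdk d k →g G,
        IsPathInducedCopy (Tdk d k) (TdkRoot d k) G φ ∧
        -- level-stable: images of the vertices at each fixed distance from the root
        -- form a stable set
        (∀ u v : TdkVertex d k, u.val.length = v.val.length → ¬ G.Adj (φ u) (φ v)) ∧
        -- type-uniform: adjacency of the images of an incomparable pair depends only on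
        -- its type `(a, b, c)` = (depth of the earlier vertex, depth of the later
        -- vertex, depth of the join)
        (∀ u v u' v' : TdkVertex d k,
          Incomp u.val v.val → Incomp u'.val v'.val →
          Earlier u.val v.val → Earlier u'.val v'.val →
          u.val.length = u'.val.length → v.val.length = v'.val.length →
          lcsLen u.val v.val = lcsLen u'.val v'.val →
          (G.Adj (φ u) (φ v) ↔ G.Adj (φ u') (φ v'))) := by
  obtain ⟨D, hD⟩ := exists_uniform_subtree (max d t) k
  obtain ⟨c, hc⟩ := exists_copy_of_cliqueFreeOn D k t
  refine ⟨c, fun V _ G hG hχ => ?_⟩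
  have hcol : ¬ ColorableOn G Set.univ c := by
    rintro ⟨f, hf, hf'⟩
    refine absurd hχ (not_lt.2 ?_)
    refine SimpleGraph.Colorable.chromaticNumber_le ⟨SimpleGraph.Coloring.mk
      (fun v => (⟨f v, hf v (Set.mem_univ v)⟩ : Fin c)) fun {u v} h heq => ?_⟩
    exact hf' u (Set.mem_univ u) v (Set.mem_univ v) h (Fin.mk.inj_iff.1 heq)
  obtain ⟨φ, hφ⟩ := hc V G Set.univ ((SimpleGraph.cliqueFreeOn_univ G).2 hG) hcol
  obtain ⟨σ, hσ, hinj, happ, huni⟩ := hD fun u v => G.Adj (φ u) (φ v)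
  have hψ := hφ.comp hσ hinj happ
  obtain ⟨θ, hθ, hcopy⟩ := hψ.exists_isPathInducedCopy (le_max_left d t)
  have hmem : ∀ v : TdkVertex d k, v.val ∈ treeLists (max d t) k :=
    fun v => v.mem_treeLists (le_max_left d t)
  refine ⟨θ, hcopy, fun u v huv => ?_, ?_⟩
  · rw [hθ, hθ]
    exact not_adj_of_length_eq_of_typeUniform (le_max_right d t) hG huni (hmem u) (hmem v) huv
  · intro u v u' v' huv huv' he he' hlu hlv hjoin
    rw [hθ, hθ, hθ, hθ]
    have hmu := hmem u
    have hmv := hmem v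
    have hmu' := hmem u'
    have hmv' := hmem v'
    obtain ⟨y, i, z, j, w, hu, hv, hij⟩ := huv.exists_join
    obtain ⟨y', i', z', j', w', hu', hv', hij'⟩ := huv'.exists_join
    rw [hu, hv] at he
    rw [hu', hv'] at he'
    rw [hu, hu'] at hlu
    rw [hv, hv'] at hlv
    rw [hu, hv, hu', hv', lcsLen_append_cons hij, lcsLen_append_cons hij'] at hjoin
    rw [Earlier, branchLabel_append_cons hij, branchLabel_append_cons hij.symm] at he
    rw [Earlier, branchLabel_append_cons hij', branchLabel_append_cons hij'.symm] at he'
    simp only [List.length_append, List.length_cons] at hlu hlv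
    obtain ⟨q, hq⟩ := huni y.length z.length w.length
    rw [hu] at hmu ⊢
    rw [hv] at hmv ⊢
    rw [hu'] at hmu' ⊢
    rw [hv'] at hmv' ⊢
    exact (hq y i z j w rfl rfl rfl he hmu hmv).trans
      (hq y' i' z' j' w' (by omega) (by omega) hjoin.symm he' hmu' hmv').symm
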